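/- Let F : ℝ → ℝ be locally Lipschitz with F(0) = 0, satisfying hypotheses (H)_1 and (H)_2, and let q > 2. Then for every ε > 0 there exists l_ε > 0 such that |F(t)| ≤ ε t² + l_ε |t|^q for every t ∈ ℝ. -/

import Mathlib

open Filter Real

/-- The Clarke generalized directional derivative of `F : ℝ → ℝ` at `t` in direction `s`:
`F⁰(t;s) = limsup_{w → t, τ → 0⁺} (F(w + τs) − F(w))/τ`. -/
noncomputable def clarkeDeriv (F : ℝ → ℝ) (t s : ℝ) : ℝ :=
  Filter.limsup (fun p : ℝ × ℝ => (F (p.1 + p.2 * s) - F p.1) / p.2)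
    ((nhds t) ×ˢ (nhdsWithin 0 (Set.Ioi 0)))

/-- The Clarke subdifferential `∂F(t) = {ξ : ξ·s ≤ F⁰(t;s) for all s}`. -/
def clarkeSubdiff (F : ℝ → ℝ) (t : ℝ) : Set ℝ :=
  {ξ : ℝ | ∀ s : ℝ, ξ * s ≤ clarkeDeriv F t s}

/-- The difference quotients of a locally Lipschitz function are locally bounded above. -/
lemma LocallyLipschitz.isBoundedUnder_diffQuot {F : ℝ → ℝ} (hF : LocallyLipschitz F) (c s : ℝ) :
    (nhds c ×ˢ nhdsWithin 0 (Set.Ioi 0)).IsBoundedUnder (· ≤ ·)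
      (fun p : ℝ × ℝ => (F (p.1 + p.2 * s) - F p.1) / p.2) := by
  obtain ⟨K, U, hU, hK⟩ := hF c
  have hfst : Tendsto (fun p : ℝ × ℝ => p.1) (nhds c ×ˢ nhdsWithin 0 (Set.Ioi 0)) (nhds c) :=
    tendsto_fst
  have hsnd : Tendsto (fun p : ℝ × ℝ => p.2) (nhds c ×ˢ nhdsWithin 0 (Set.Ioi 0))
      (nhdsWithin 0 (Set.Ioi 0)) := tendsto_snd
  have hadd : Tendsto (fun p : ℝ × ℝ => p.1 + p.2 * s) (nhds c ×ˢ nhdsWithin 0 (Set.Ioi 0))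
      (nhds c) := by
    simpa using hfst.add ((tendsto_nhds_of_tendsto_nhdsWithin hsnd).mul_const s)
  refine isBoundedUnder_of_eventually_le (a := K * |s|) ?_
  filter_upwards [hfst hU, hadd hU, hsnd self_mem_nhdsWithin] with p hp hps hτ
  have hτ : 0 < p.2 := hτ
  have hdist := hK.dist_le_mul _ hps _ hp
  rw [Real.dist_eq, Real.dist_eq, add_sub_cancel_left, abs_mul, abs_of_pos hτ] at hdist
  rw [div_le_iff₀ hτ]
  linarith [le_abs_self (F (p.1 + p.2 * s) - F p.1)]

/-- If `F` minus a linear function of slope `ξ` has a local extremum at `c`, then `ξ ∈ ∂F(c)`. -/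
lemma LocallyLipschitz.mem_clarkeSubdiff_of_isLocalExtr {F : ℝ → ℝ} (hF : LocallyLipschitz F)
    {c ξ : ℝ} (h : IsLocalExtr (fun x => F x - ξ * x) c) : ξ ∈ clarkeSubdiff F c := by
  intro s
  refine le_limsup_of_frequently_le ?_ (hF.isBoundedUnder_diffQuot c s)
  have hid : Tendsto (fun τ : ℝ => τ) (nhdsWithin 0 (Set.Ioi 0)) (nhds 0) :=
    tendsto_nhds_of_tendsto_nhdsWithin tendsto_id
  rcases h with h | h
  · have hadd : Tendsto (fun τ : ℝ => c + τ * s) (nhdsWithin 0 (Set.Ioi 0)) (nhds c) := by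
      simpa using (hid.mul_const s).const_add c
    refine (tendsto_const_nhds.prodMk tendsto_id).frequently (Eventually.frequently ?_)
    filter_upwards [hadd.eventually h, self_mem_nhdsWithin] with τ hmin hτ
    have hτ : 0 < τ := hτ
    simp only [id]
    rw [le_div_iff₀ hτ]
    linarith
  · have hsub : Tendsto (fun τ : ℝ => c - τ * s) (nhdsWithin 0 (Set.Ioi 0)) (nhds c) := by
      simpa using (hid.mul_const s).const_sub c
    refine (hsub.prodMk tendsto_id).frequently (Eventually.frequently ?_)
    filter_upwards [hsub.eventually h, self_mem_nhdsWithin] with τ hmax hτ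
    have hτ : 0 < τ := hτ
    simp only [id, sub_add_cancel]
    rw [le_div_iff₀ hτ]
    linarith

/-- The Lebourg mean value theorem on the real line. -/
lemma LocallyLipschitz.exists_mem_clarkeSubdiff_eq {F : ℝ → ℝ} (hF : LocallyLipschitz F)
    {a b : ℝ} (hab : a < b) :
    ∃ c ∈ Set.Ioo a b, ∃ ξ ∈ clarkeSubdiff F c, F b - F a = ξ * (b - a) := by
  have hne : b - a ≠ 0 := (sub_pos.2 hab).ne'
  have hslope : (F b - F a) / (b - a) * (b - a) = F b - F a := div_mul_cancel₀ _ hne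
  obtain ⟨c, hc, hext⟩ := exists_isLocalExtr_Ioo
    (f := fun x => F x - (F b - F a) / (b - a) * x) hab
    (hF.continuous.sub (continuous_const.mul continuous_id)).continuousOn (by linarith)
  exact ⟨c, hc, _, hF.mem_clarkeSubdiff_of_isLocalExtr hext, hslope.symm⟩

/-- A bound on the Clarke subdifferential strictly between two points bounds the increment. -/
lemma LocallyLipschitz.abs_sub_le_of_clarkeSubdiff {F : ℝ → ℝ} (hF : LocallyLipschitz F)
    {a b C : ℝ} (h : ∀ c ∈ Set.Ioo (min a b) (max a b), ∀ ξ ∈ clarkeSubdiff F c, |ξ| ≤ C) :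
    |F b - F a| ≤ C * |b - a| := by
  rcases lt_trichotomy a b with hab | rfl | hab
  · obtain ⟨c, hc, ξ, hξ, heq⟩ := hF.exists_mem_clarkeSubdiff_eq hab
    rw [min_eq_left hab.le, max_eq_right hab.le] at h
    rw [heq, abs_mul]
    exact mul_le_mul_of_nonneg_right (h c hc ξ hξ) (abs_nonneg _)
  · simp
  · obtain ⟨c, hc, ξ, hξ, heq⟩ := hF.exists_mem_clarkeSubdiff_eq hab
    rw [min_eq_right hab.le, max_eq_left hab.le] at h
    rw [abs_sub_comm, abs_sub_comm b, heq, abs_mul]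
    exact mul_le_mul_of_nonneg_right (h c hc ξ hξ) (abs_nonneg _)

/-- Hypothesis `(H)_1` makes `F` quadratically small near the origin. -/
lemma LocallyLipschitz.abs_le_mul_sq_of_abs_lt {F : ℝ → ℝ} (hF : LocallyLipschitz F)
    (hF0 : F 0 = 0) {ε δ : ℝ} (hε : 0 ≤ ε)
    (h : ∀ t : ℝ, 0 < |t| → |t| < δ → ∀ ξ ∈ clarkeSubdiff F t, |ξ| ≤ ε * |t|)
    {t : ℝ} (ht : |t| < δ) : |F t| ≤ ε * t ^ 2 := by
  have key : |F t - F 0| ≤ ε * |t| * |t - 0| := by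
    refine hF.abs_sub_le_of_clarkeSubdiff fun c hc ξ hξ => ?_
    have hct : 0 < |c| ∧ |c| ≤ |t| := by
      rcases le_total 0 t with h0 | h0
      · rw [min_eq_left h0, max_eq_right h0] at hc
        rw [abs_of_pos hc.1, abs_of_nonneg h0]
        exact ⟨hc.1, hc.2.le⟩
      · rw [min_eq_right h0, max_eq_left h0] at hc
        rw [abs_of_neg hc.2, abs_of_nonpos h0]
        exact ⟨neg_pos.2 hc.2, neg_le_neg hc.1.le⟩
    exact (h c hct.1 (hct.2.trans_lt ht) ξ hξ).trans (mul_le_mul_of_nonneg_left hct.2 hε)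
  rwa [hF0, sub_zero, sub_zero, mul_assoc, abs_mul_abs_self, ← sq] at key

/-- Hypothesis `(H)_2` makes `F` grow at most quadratically, up to an additive constant. -/
lemma LocallyLipschitz.exists_abs_le_add_mul_sq {F : ℝ → ℝ} (hF : LocallyLipschitz F)
    {ε T : ℝ} (hε : 0 ≤ ε) (hT : 0 ≤ T)
    (h : ∀ t : ℝ, T < |t| → ∀ ξ ∈ clarkeSubdiff F t, |ξ| ≤ ε * |t|) :
    ∃ M : ℝ, ∀ t : ℝ, |F t| ≤ M + ε * t ^ 2 := by
  obtain ⟨M, hM⟩ := (isCompact_Icc (a := -T) (b := T)).exists_bound_of_continuousOn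
    hF.continuous.continuousOn
  simp only [Real.norm_eq_abs] at hM
  refine ⟨M, fun t => ?_⟩
  have of_base : ∀ a ∈ Set.Icc (-T) T, |t - a| ≤ |t| →
      (∀ c ∈ Set.Ioo (min a t) (max a t), T < |c| ∧ |c| ≤ |t|) → |F t| ≤ M + ε * t ^ 2 := by
    intro a ha hat hc
    have key : |F t - F a| ≤ ε * |t| * |t - a| :=
      hF.abs_sub_le_of_clarkeSubdiff fun c hcI ξ hξ =>
        (h c (hc c hcI).1 ξ hξ).trans (mul_le_mul_of_nonneg_left (hc c hcI).2 hε)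
    have hsq : ε * |t| * |t - a| ≤ ε * t ^ 2 := by
      rw [← sq_abs t, sq, ← mul_assoc]
      gcongr
    linarith [hM a ha, abs_sub_abs_le_abs_sub (F t) (F a)]
  rcases lt_or_ge T t with h1 | h1
  · refine of_base T ⟨by linarith, le_rfl⟩ ?_ fun c hc => ?_
    · rw [abs_of_nonneg (by linarith), abs_of_nonneg (by linarith)]
      linarith
    · rw [min_eq_left h1.le, max_eq_right h1.le] at hc
      rw [abs_of_pos (hT.trans_lt hc.1), abs_of_nonneg (by linarith)]
      exact ⟨hc.1, hc.2.le⟩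
  rcases lt_or_ge t (-T) with h2 | h2
  · refine of_base (-T) ⟨le_rfl, by linarith⟩ ?_ fun c hc => ?_
    · rw [abs_of_nonpos (by linarith), abs_of_nonpos (by linarith)]
      linarith
    · rw [min_eq_right h2.le, max_eq_left h2.le] at hc
      rw [abs_of_neg (by linarith [hc.2]), abs_of_nonpos (by linarith)]
      exact ⟨by linarith [hc.2], by linarith [hc.1]⟩
  · have := hM t ⟨h2, h1⟩
    nlinarith [sq_nonneg t]

theorem stmt_2 (F : ℝ → ℝ) (hF : LocallyLipschitz F) (hF0 : F 0 = 0)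
    (H1 : ∀ ε > (0 : ℝ), ∃ δ > (0 : ℝ), ∀ t : ℝ, 0 < |t| → |t| < δ →
      ∀ ξ ∈ clarkeSubdiff F t, |ξ| ≤ ε * |t|)
    (H2 : ∀ ε > (0 : ℝ), ∃ T > (0 : ℝ), ∀ t : ℝ, T < |t| →
      ∀ ξ ∈ clarkeSubdiff F t, |ξ| ≤ ε * |t|)
    (q : ℝ) (hq : 2 < q) :
    ∀ ε > (0 : ℝ), ∃ l > (0 : ℝ), ∀ t : ℝ,
      |F t| ≤ ε * t ^ 2 + l * |t| ^ q := by
  intro ε hε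
  obtain ⟨δ, hδ, hsmall⟩ := H1 ε hε
  obtain ⟨T, hT, hlarge⟩ := H2 ε hε
  obtain ⟨M, hM⟩ := hF.exists_abs_le_add_mul_sq hε.le hT.le hlarge
  have hM0 : 0 ≤ M := by simpa [hF0] using hM 0
  have hδq : 0 < δ ^ q := Real.rpow_pos_of_pos hδ q
  have hl : 0 < (M + 1) / δ ^ q := by positivity
  refine ⟨(M + 1) / δ ^ q, hl, fun t => ?_⟩
  rcases lt_or_ge |t| δ with ht | ht
  · exact (hF.abs_le_mul_sq_of_abs_lt hF0 hε.le hsmall ht).trans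
      (le_add_of_nonneg_right (by positivity))
  · have hpow : M + 1 ≤ (M + 1) / δ ^ q * |t| ^ q := by
      rw [div_mul_eq_mul_div, le_div_iff₀ hδq]
      gcongr
    linarith [hM t]
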